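/- Fix reals E > 0, I > 0, ℓ > 0. For a load F > 0 and a contact point a ∈ (0, ℓ], let γ_{F,a} : [0,1] → ℝ denote the beam deflection defined by γ_{F,a}(s) = −F·(sℓ)²·(3a − sℓ)/(6·E·I) for 0 ≤ s ≤ a/ℓ and γ_{F,a}(s) = −F·a²·(3·sℓ − a)/(6·E·I) for a/ℓ ≤ s ≤ 1. Then the map (F, a) ↦ γ_{F,a} is injective on (0, ∞) × (0, ℓ]: if F₁, F₂ > 0, a₁, a₂ ∈ (0, ℓ], and γ_{F₁,a₁}(s) = γ_{F₂,a₂}(s) for all s ∈ [0,1], then F₁ = F₂ and a₁ = a₂. In particular, the full deflection profile of the sensor determines both the applied load and the point of contact, so a deflection sensor reporting the profile can simulate the composition of a load sensor and a contact detector strip. -/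

import Mathlib

open scoped Classical

/-- Cantilever beam deflection at normalized position `s ∈ [0,1]` along a beam
of length `ℓ` (Young's modulus `E`, area moment of inertia `I`) subject to a
transverse point load `F` applied at distance `a` from the base. -/
noncomputable def beamDeflection (E I ℓ F a s : ℝ) : ℝ :=
  if s ≤ a / ℓ then -F * (s * ℓ) ^ 2 * (3 * a - s * ℓ) / (6 * E * I)
  else -F * a ^ 2 * (3 * (s * ℓ) - a) / (6 * E * I)

/-- the map `(F, a) ↦ γ_{F,a}` is injective on `(0,∞) × (0,ℓ]`:
the full deflection profile on `[0,1]` determines both the applied load and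
the point of contact.  Hence a deflection sensor reporting the profile can
simulate the composition of a load sensor and a contact detector strip. -/
theorem beam_deflection_profile_determines_load_and_contact
    (E I ℓ : ℝ) (hE : 0 < E) (hI : 0 < I) (hℓ : 0 < ℓ)
    (F₁ F₂ a₁ a₂ : ℝ) (hF₁ : 0 < F₁) (hF₂ : 0 < F₂)
    (ha₁ : a₁ ∈ Set.Ioc 0 ℓ) (ha₂ : a₂ ∈ Set.Ioc 0 ℓ)
    (hprof : ∀ s ∈ Set.Icc (0:ℝ) 1,
      beamDeflection E I ℓ F₁ a₁ s = beamDeflection E I ℓ F₂ a₂ s) :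
    F₁ = F₂ ∧ a₁ = a₂ := by
  obtain ⟨h1, h1l⟩ := ha₁
  obtain ⟨h2, h2l⟩ := ha₂
  have key : ∀ x : ℝ, 0 < x → x ≤ a₁ → x ≤ a₂ →
      F₁ * (3 * a₁ - x) = F₂ * (3 * a₂ - x) := by
    intro x hx hx1 hx2
    have h := hprof (x / ℓ) ⟨by positivity, by rw [div_le_one hℓ]; linarith⟩
    have e1 : x / ℓ ≤ a₁ / ℓ := by gcongr
    have e2 : x / ℓ ≤ a₂ / ℓ := by gcongr
    unfold beamDeflection at h
    rw [if_pos e1, if_pos e2, div_mul_cancel₀ x hℓ.ne',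
      div_left_inj' (by positivity)] at h
    have hx' : x ^ 2 ≠ 0 := by positivity
    apply mul_left_cancel₀ hx'
    linarith
  have hm : 0 < min a₁ a₂ := lt_min h1 h2
  have k1 := key (min a₁ a₂) hm (min_le_left _ _) (min_le_right _ _)
  have k2 := key (min a₁ a₂ / 2) (by linarith)
    (by linarith [min_le_left a₁ a₂]) (by linarith [min_le_right a₁ a₂])
  have hF : F₁ = F₂ := by
    apply mul_right_cancel₀ hm.ne'
    linarith
  refine ⟨hF, ?_⟩
  subst hF
  have := mul_left_cancel₀ hF₁.ne' k1
  linarith
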